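/- Define h : ^{<ω}2 → ^{<ω}2 recursively by h(⟨⟩) = ⟨1⟩, h(η⌢⟨0⟩) = h(η)⁻⌢⟨0,0,1⟩, and h(η⌢⟨1⟩) = h(η)⁻⌢⟨0,1,1⟩. Then: (a) for all finite binary strings η ◁ ν, one has h(η)⁻⌢⟨1⟩ = h(η) and h(η)⁻⌢⟨0⟩ ⊴ h(ν), and consequently h(η) ⊥ h(ν); and (b) for any pairwise incomparable finite binary strings η₀,…,ηₙ and any finite binary strings ν₀,…,νₙ all of the same length with ηᵢ ⊴ νᵢ for each i ≤ n, cl(⟨h(η₀),…,h(ηₙ)⟩) ≈_β cl(⟨h(ν₀),…,h(νₙ)⟩). (Final claims in the proof of Theorem 4.8.) -/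

import Mathlib

/-- The meet `η ∧ ν` of two finite binary strings: their longest common prefix. -/
def lcp : List Bool → List Bool → List Bool
  | a :: as, b :: bs => if a = b then a :: lcp as bs else []
  | _, _ => []

/-- `η ⊥ ν`: the strings are incomparable (neither is a prefix of the other). -/
def Incomp (a b : List Bool) : Prop := ¬ a <+: b ∧ ¬ b <+: a

/-- A tuple of strings is ∧-closed if the meet of any two entries is again an entry. -/
def MeetClosed {ι : Type*} (t : ι → List Bool) : Prop :=
  ∀ i j : ι, ∃ k : ι, lcp (t i) (t j) = t k

/-- `s ≈_α t`: both tuples are ∧-closed, and they satisfy the same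
`⊴`-relations and the same `⌢⟨d⟩⊴`-relations between entries. -/
def EqvA {ι : Type*} (s t : ι → List Bool) : Prop :=
  MeetClosed s ∧ MeetClosed t ∧
  (∀ i j : ι, s i <+: s j ↔ t i <+: t j) ∧
  (∀ (i j : ι) (d : Bool), s i ++ [d] <+: s j ↔ t i ++ [d] <+: t j)

/-- `s ≈_β t`: `≈_α` together with preservation of the relation `ηᵢ⌢⟨1⟩ = ηⱼ`. -/
def EqvB {ι : Type*} (s t : ι → List Bool) : Prop :=
  EqvA s t ∧ ∀ i j : ι, s i ++ [true] = s j ↔ t i ++ [true] = t j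

/-- `s ≈_γ t`: `≈_β` together with preservation of `ηᵢ⌢⟨0⟩ = ηⱼ` and of
ending with `0` resp. with `1`. -/
def EqvG {ι : Type*} (s t : ι → List Bool) : Prop :=
  EqvB s t ∧
  (∀ i j : ι, s i ++ [false] = s j ↔ t i ++ [false] = t j) ∧
  (∀ i : ι, (s i).getLast? = some false ↔ (t i).getLast? = some false) ∧
  (∀ i : ι, (s i).getLast? = some true ↔ (t i).getLast? = some true)

/-- The meet-closure tuple of a tuple of strings: all pairwise meets. -/
def cl {ι : Type*} (t : ι → List Bool) : ι × ι → List Bool :=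
  fun p => lcp (t p.1) (t p.2)

theorem lcp_self (a : List Bool) : lcp a a = a := by
  induction a with
  | nil => rfl
  | cons x a ih => simp [lcp, ih]

theorem prefix_lcp_iff (p a b : List Bool) : p <+: lcp a b ↔ p <+: a ∧ p <+: b := by
  induction p generalizing a b with
  | nil => simp
  | cons x p ih =>
    cases a with
    | nil => simp [lcp]
    | cons y a =>
      cases b with
      | nil => simp [lcp]
      | cons z b =>
        by_cases hyz : y = z
        · subst hyz
          simp only [lcp, if_true, List.cons_prefix_cons, ih]
          tauto
        · simp only [lcp, hyz, if_false, List.cons_prefix_cons, List.prefix_nil]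
          grind

theorem prefix_antisymm {a b : List Bool} (hab : a <+: b) (hba : b <+: a) : a = b :=
  hab.eq_of_length_le hba.length_le

theorem eq_of_prefix_iff {a b : List Bool} (hab : ∀ p, p <+: a ↔ p <+: b) : a = b :=
  prefix_antisymm ((hab a).1 List.prefix_rfl) ((hab b).2 List.prefix_rfl)

theorem lcp_prefix_left (a b : List Bool) : lcp a b <+: a :=
  ((prefix_lcp_iff _ a b).1 List.prefix_rfl).1

theorem lcp_prefix_right (a b : List Bool) : lcp a b <+: b :=
  ((prefix_lcp_iff _ a b).1 List.prefix_rfl).2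

theorem lcp_eq_left {a b : List Bool} (hab : a <+: b) : lcp a b = a :=
  prefix_antisymm (lcp_prefix_left a b) ((prefix_lcp_iff a a b).2 ⟨List.prefix_rfl, hab⟩)

theorem lcp_eq_right {a b : List Bool} (hba : b <+: a) : lcp a b = b :=
  prefix_antisymm (lcp_prefix_right a b) ((prefix_lcp_iff b a b).2 ⟨hba, List.prefix_rfl⟩)

theorem lcp_assoc (a b c : List Bool) : lcp (lcp a b) c = lcp a (lcp b c) :=
  eq_of_prefix_iff fun p => by simp only [prefix_lcp_iff, and_assoc]

/-- The meet of three strings is already the meet of two consecutive ones. -/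
theorem lcp_lcp_eq_or (a b c : List Bool) :
    lcp (lcp a b) c = lcp a b ∨ lcp (lcp a b) c = lcp b c := by
  have key : lcp (lcp a b) c = lcp (lcp a b) (lcp b c) :=
    eq_of_prefix_iff fun p => by
      simp only [prefix_lcp_iff]
      tauto
  rw [key]
  rcases List.prefix_or_prefix_of_prefix (lcp_prefix_right a b) (lcp_prefix_left b c) with h | h
  · exact Or.inl (lcp_eq_left h)
  · exact Or.inr (lcp_eq_right h)

theorem meetClosed_cl {ι : Type*} (t : ι → List Bool) : MeetClosed (cl t) := by
  rintro ⟨i, j⟩ ⟨k, l⟩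
  simp only [cl, Prod.exists]
  rw [← lcp_assoc]
  rcases lcp_lcp_eq_or (t i) (t j) (t k) with h | h <;> rw [h]
  · rcases lcp_lcp_eq_or (t i) (t j) (t l) with h' | h' <;> exact ⟨_, _, h'⟩
  · rcases lcp_lcp_eq_or (t j) (t k) (t l) with h' | h' <;> exact ⟨_, _, h'⟩

theorem lcp_eq_lcp_of_incomp {a b a' b' : List Bool} (hab : Incomp a b)
    (ha : a <+: a') (hb : b <+: b') : lcp a' b' = lcp a b := by
  refine eq_of_prefix_iff fun p => ?_
  simp only [prefix_lcp_iff]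
  refine ⟨fun ⟨h₁, h₂⟩ => ?_, fun ⟨h₁, h₂⟩ => ⟨h₁.trans ha, h₂.trans hb⟩⟩
  rcases List.prefix_or_prefix_of_prefix h₁ ha with h₃ | h₃ <;>
    rcases List.prefix_or_prefix_of_prefix h₂ hb with h₄ | h₄
  · exact ⟨h₃, h₄⟩
  · exact absurd (h₄.trans h₃) hab.2
  · exact absurd (h₃.trans h₄) hab.1
  · rcases List.prefix_or_prefix_of_prefix h₃ h₄ with h₅ | h₅
    · exact absurd h₅ hab.1
    · exact absurd h₅ hab.2

theorem Incomp.mono {a b a' b' : List Bool} (hab : Incomp a b)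
    (ha : a <+: a') (hb : b <+: b') : Incomp a' b' := by
  constructor
  · intro h
    rcases List.prefix_or_prefix_of_prefix (ha.trans h) hb with h' | h'
    exacts [hab.1 h', hab.2 h']
  · intro h
    rcases List.prefix_or_prefix_of_prefix ha (hb.trans h) with h' | h'
    exacts [hab.1 h', hab.2 h']

/-- Insert a `0` before every entry of a string. -/
def interleaveZero : List Bool → List Bool
  | [] => []
  | d :: l => false :: d :: interleaveZero l

theorem interleaveZero_append (a b : List Bool) :
    interleaveZero (a ++ b) = interleaveZero a ++ interleaveZero b := by
  induction a with
  | nil => rfl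
  | cons x a ih => simp [interleaveZero, ih]

theorem length_interleaveZero (a : List Bool) : (interleaveZero a).length = 2 * a.length := by
  induction a with
  | nil => rfl
  | cons x a ih => simp [interleaveZero, ih]; ring

theorem leaf_prefix_leaf_iff (a b : List Bool) :
    interleaveZero a ++ [true] <+: interleaveZero b ++ [true] ↔ a = b := by
  induction a generalizing b with
  | nil => cases b <;> simp [interleaveZero]
  | cons x a ih => cases b <;> simp [interleaveZero, ih]

theorem not_leaf_append_prefix_leaf (a b : List Bool) (d : Bool) :
    ¬ interleaveZero a ++ [true] ++ [d] <+: interleaveZero b ++ [true] := by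
  intro h
  have hab := (leaf_prefix_leaf_iff a b).1 ((List.prefix_append _ _).trans h)
  subst hab
  simpa using h.length_le

theorem not_leaf_prefix_branch (a b : List Bool) :
    ¬ interleaveZero a ++ [true] <+: interleaveZero b ++ [false] := by
  induction a generalizing b with
  | nil => cases b <;> simp [interleaveZero]
  | cons x a ih => cases b <;> simp [interleaveZero, ih]

theorem branch_append_prefix_leaf_iff (a b : List Bool) (d : Bool) :
    interleaveZero a ++ [false] ++ [d] <+: interleaveZero b ++ [true] ↔ a ++ [d] <+: b := by
  induction a generalizing b with
  | nil => cases b <;> simp [interleaveZero]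
  | cons x a ih =>
    cases b with
    | nil => simp [interleaveZero]
    | cons y b => simpa [interleaveZero] using fun _ => ih b

theorem branch_prefix_leaf_iff (a b : List Bool) :
    interleaveZero a ++ [false] <+: interleaveZero b ++ [true] ↔ ∃ d, a ++ [d] <+: b := by
  induction a generalizing b with
  | nil => cases b <;> simp [interleaveZero]
  | cons x a ih =>
    cases b with
    | nil => simp [interleaveZero]
    | cons y b => simpa [interleaveZero] using fun _ => ih b

theorem lcp_leaf_leaf {a b : List Bool} (hab : Incomp a b) :
    lcp (interleaveZero a ++ [true]) (interleaveZero b ++ [true]) =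
      interleaveZero (lcp a b) ++ [false] := by
  induction a generalizing b with
  | nil => exact absurd List.nil_prefix hab.1
  | cons x a ih =>
    cases b with
    | nil => exact absurd List.nil_prefix hab.2
    | cons y b =>
      by_cases hxy : x = y
      · subst hxy
        have hab' : Incomp a b := by simpa [Incomp] using hab
        simp [interleaveZero, lcp, ih hab']
      · simp [interleaveZero, lcp, hxy]

theorem leaf_append_ne (a b : List Bool) (d : Bool) :
    interleaveZero a ++ [d] ++ [true] ≠ interleaveZero b ++ [true] := by
  intro h
  have := congrArg List.length h
  simp only [List.length_append, length_interleaveZero, List.length_singleton] at this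
  omega

theorem exists_append_prefix_of_prefix_of_ne {a b : List Bool} (hab : a <+: b) (hne : a ≠ b) :
    ∃ d, a ++ [d] <+: b := by
  obtain ⟨t, rfl⟩ := hab
  cases t with
  | nil => simp at hne
  | cons d t => exact ⟨d, by simp⟩

/-- One-step extensions of a branching point of an antichain are below a member of the antichain
iff they are below a given end extension of that member. -/
theorem append_prefix_iff_of_incomp {a σ b b' : List Bool} (d : Bool) (hσ : σ <+: a)
    (hab : σ <+: b ∨ Incomp a b) (hne : b ≠ σ) (hb : b <+: b') :
    σ ++ [d] <+: b ↔ σ ++ [d] <+: b' := by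
  refine ⟨fun h => h.trans hb, fun h => ?_⟩
  rcases List.prefix_or_prefix_of_prefix h hb with h' | h'
  · exact h'
  · rcases List.prefix_concat_iff.1 h' with h' | h'
    · rw [h']
    · rcases hab with hab | hab
      · exact absurd (prefix_antisymm h' hab) hne
      · exact absurd (h'.trans hσ) hab.2

theorem eqvB_cl_leaf {ι : Type*} (η ν : ι → List Bool)
    (hη : ∀ i j, i ≠ j → Incomp (η i) (η j)) (hην : ∀ i, η i <+: ν i) :
    EqvB (cl fun i => interleaveZero (η i) ++ [true])
      (cl fun i => interleaveZero (ν i) ++ [true]) := by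
  have hν : ∀ i j, i ≠ j → Incomp (ν i) (ν j) := fun i j hij => (hη i j hij).mono (hην i) (hην j)
  have inj : ∀ i j, η i = η j ↔ ν i = ν j := by
    intro i j
    by_cases hij : i = j
    · simp [hij]
    · exact ⟨fun h => absurd (h ▸ List.prefix_rfl) (hη i j hij).1,
        fun h => absurd (h ▸ List.prefix_rfl) (hν i j hij).1⟩
  have step : ∀ i j k d, i ≠ j →
      (lcp (η i) (η j) ++ [d] <+: η k ↔ lcp (η i) (η j) ++ [d] <+: ν k) := by
    intro i j k d hij
    refine append_prefix_iff_of_incomp (a := η i) d (lcp_prefix_left _ _) ?_ ?_ (hην k)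
    · by_cases hik : i = k
      · exact Or.inl (hik ▸ lcp_prefix_left _ _)
      · exact Or.inr (hη i k hik)
    · intro h
      by_cases hik : i = k
      · exact (hη k j (hik ▸ hij)).1 (h ▸ lcp_prefix_right _ _)
      · exact (hη k i (Ne.symm hik)).1 (h ▸ lcp_prefix_left _ _)
  have leafη : ∀ i j, i ≠ j → lcp (interleaveZero (η i) ++ [true]) (interleaveZero (η j) ++ [true])
      = interleaveZero (lcp (η i) (η j)) ++ [false] := fun i j hij => lcp_leaf_leaf (hη i j hij)
  have leafν : ∀ i j, i ≠ j → lcp (interleaveZero (ν i) ++ [true]) (interleaveZero (ν j) ++ [true])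
      = interleaveZero (lcp (η i) (η j)) ++ [false] := fun i j hij => by
    rw [lcp_leaf_leaf (hν i j hij), lcp_eq_lcp_of_incomp (hη i j hij) (hην i) (hην j)]
  refine ⟨⟨meetClosed_cl _, meetClosed_cl _, ?_, ?_⟩, ?_⟩
  · rintro ⟨i, j⟩ ⟨k, l⟩
    simp only [cl]
    by_cases hij : i = j <;> by_cases hkl : k = l
    · subst hij hkl
      simp only [lcp_self, leaf_prefix_leaf_iff, inj]
    · subst hij
      simp only [lcp_self, leafη k l hkl, leafν k l hkl, not_leaf_prefix_branch]
    · subst hkl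
      simp only [lcp_self, leafη i j hij, leafν i j hij, branch_prefix_leaf_iff,
        step i j k _ hij]
    · rw [leafη i j hij, leafν i j hij, leafη k l hkl, leafν k l hkl]
  · rintro ⟨i, j⟩ ⟨k, l⟩ d
    simp only [cl]
    by_cases hij : i = j <;> by_cases hkl : k = l
    · subst hij hkl
      simp only [lcp_self, not_leaf_append_prefix_leaf]
    · subst hij
      simp only [lcp_self, leafη k l hkl, leafν k l hkl]
      exact ⟨fun h => absurd ((List.prefix_append _ _).trans h) (not_leaf_prefix_branch _ _),
        fun h => absurd ((List.prefix_append _ _).trans h) (not_leaf_prefix_branch _ _)⟩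
    · subst hkl
      simp only [lcp_self, leafη i j hij, leafν i j hij, branch_append_prefix_leaf_iff,
        step i j k _ hij]
    · rw [leafη i j hij, leafν i j hij, leafη k l hkl, leafν k l hkl]
  · rintro ⟨i, j⟩ ⟨k, l⟩
    simp only [cl]
    by_cases hij : i = j <;> by_cases hkl : k = l
    · subst hij hkl
      simp only [lcp_self, leaf_append_ne]
    · subst hij
      simp only [lcp_self, leafη k l hkl, leafν k l hkl]
      exact ⟨fun h => absurd (h ▸ List.prefix_append _ _) (not_leaf_prefix_branch _ _),
        fun h => absurd (h ▸ List.prefix_append _ _) (not_leaf_prefix_branch _ _)⟩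
    · subst hkl
      simp only [lcp_self, leafη i j hij, leafν i j hij, leaf_append_ne]
    · rw [leafη i j hij, leafν i j hij, leafη k l hkl, leafν k l hkl]

/-- Final claims in the proof of Theorem 4.8, for the map `h` determined by
`h(⟨⟩) = ⟨1⟩`, `h(η⌢⟨0⟩) = h(η)⁻⌢⟨0,0,1⟩`, `h(η⌢⟨1⟩) = h(η)⁻⌢⟨0,1,1⟩`:
(a) for `η ◁ ν` one has `h(η)⁻⌢⟨1⟩ = h(η)`, `h(η)⁻⌢⟨0⟩ ⊴ h(ν)`, and
`h(η) ⊥ h(ν)`; (b) if `η₀,…,ηₙ` are pairwise incomparable, `ν₀,…,νₙ` all have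
the same length and `ηᵢ ⊴ νᵢ`, then
`cl(⟨h(η₀),…,h(ηₙ)⟩) ≈_β cl(⟨h(ν₀),…,h(νₙ)⟩)`. -/
theorem stmt14 (h : List Bool → List Bool)
    (h0 : h [] = [true])
    (hF : ∀ η : List Bool, h (η ++ [false]) = (h η).dropLast ++ [false, false, true])
    (hT : ∀ η : List Bool, h (η ++ [true]) = (h η).dropLast ++ [false, true, true]) :
    (∀ η ν : List Bool, η <+: ν → η ≠ ν →
      (h η).dropLast ++ [true] = h η ∧
      (h η).dropLast ++ [false] <+: h ν ∧
      Incomp (h η) (h ν)) ∧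
    (∀ (n : ℕ) (η ν : Fin (n + 1) → List Bool),
      (∀ i j, i ≠ j → Incomp (η i) (η j)) →
      (∀ i j, (ν i).length = (ν j).length) →
      (∀ i, η i <+: ν i) →
      EqvB (cl (fun i => h (η i))) (cl (fun i => h (ν i)))) := by
  have hleaf : ∀ η, h η = interleaveZero η ++ [true] := by
    intro η
    induction η using List.reverseRecOn with
    | nil => exact h0
    | append_singleton η d ih =>
      cases d
      · simp [hF, ih, interleaveZero_append, interleaveZero]
      · simp [hT, ih, interleaveZero_append, interleaveZero]
  obtain rfl : h = fun η => interleaveZero η ++ [true] := funext hleaf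
  refine ⟨fun η ν hην hne => ⟨by simp, ?_, ?_⟩, fun n η ν hη _ hην => eqvB_cl_leaf η ν hη hην⟩
  · simpa only [List.dropLast_concat, branch_prefix_leaf_iff] using
      exists_append_prefix_of_prefix_of_ne hην hne
  · simpa only [Incomp, leaf_prefix_leaf_iff] using ⟨hne, hne.symm⟩
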